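/- Assume d ≥ 5. There exists C₂ > 0 such that for all x ∈ Z^d and all T ≥ 1, (1/T) G⋆G_T(x) ≤ C₂ · min( 1/(1+‖x‖^{d−2}), 1/(T(1+‖x‖^{d−4})) ), where G⋆G_T is the convolution of the Green's function G with the truncated Green's function G_T. -/

import Mathlib

open Filter Finset MeasureTheory
open scoped symmDiff ENNReal

namespace SRW

/-- Vertices of `ℤ^d`. -/
abbrev V (d : ℕ) : Type := Fin d → ℤ

/-- The set of nearest-neighbor steps (the `2d` unit vectors `±e_i`) in `ℤ^d`. -/
def steps (d : ℕ) : Finset (V d) :=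
  (Finset.univ : Finset (Fin d × Bool)).image
    (fun p j => if j = p.1 then (if p.2 then 1 else -1) else 0)

/-- Position at time `k` of the walk started at `x` with step sequence `s`. -/
def pos {d : ℕ} (x : V d) (s : ℕ → V d) (k : ℕ) : V d :=
  x + ∑ i ∈ Finset.range k, s i

open Classical in
/-- Probability, for the simple random walk, of an event depending on the
first `n` steps (steps beyond `n` are set to `0`): each of the `(2d)^n`
admissible step sequences has equal probability. -/
noncomputable def probN (d n : ℕ) (P : (ℕ → V d) → Prop) : ℝ :=
  (((Fintype.piFinset fun _ : Fin n => steps d).filter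
      (fun s => P fun i => if h : i < n then s ⟨i, h⟩ else 0)).card : ℝ) / ((2 * d : ℕ) : ℝ) ^ n

/-- Expectation of a functional of the first `n` steps of the walk. -/
noncomputable def expN (d n : ℕ) (f : (ℕ → V d) → ℝ) : ℝ :=
  (∑ s ∈ Fintype.piFinset fun _ : Fin n => steps d,
      f fun i => if h : i < n then s ⟨i, h⟩ else 0) / ((2 * d : ℕ) : ℝ) ^ n

/-- Escape probability `P_x(H_A^+ = ∞)`: the walk started at `x` never
hits `A` at a positive time (decreasing limit of the finite-horizon events). -/
noncomputable def esc (d : ℕ) (A : Set (V d)) (x : V d) : ℝ :=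
  ⨅ n : ℕ, probN d n (fun s => ∀ k, 1 ≤ k → k ≤ n → pos x s k ∉ A)

/-- Newtonian capacity `Cap(A) = Σ_{x∈A} P_x(H_A^+ = ∞)`. -/
noncomputable def cap {d : ℕ} (A : Finset (V d)) : ℝ :=
  ∑ x ∈ A, esc d (↑A) x

/-- Green's function `G(z) = Σ_n P_0(S_n = z)`. -/
noncomputable def G (d : ℕ) (z : V d) : ℝ :=
  ∑' n : ℕ, probN d n (fun s => pos 0 s n = z)

/-- Truncated Green's function `G_T(z) = Σ_{n≤T} P_0(S_n = z)`. -/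
noncomputable def GT (d T : ℕ) (z : V d) : ℝ :=
  ∑ n ∈ Finset.range (T + 1), probN d n (fun s => pos 0 s n = z)

/-- Convolution `(G ⋆ G_T)(x) = Σ_y G(x-y) G_T(y)`. -/
noncomputable def GconvGT (d T : ℕ) (x : V d) : ℝ :=
  ∑' y : V d, G d (x - y) * GT d T y

/-- Euclidean norm on `ℤ^d`. -/
noncomputable def nrm {d : ℕ} (x : V d) : ℝ :=
  Real.sqrt (∑ i, ((x i : ℝ)) ^ 2)

/-- The range `{S_k : k ∈ I}` of the walk started at `x` over the set of times `I`. -/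
noncomputable def rangeOn {d : ℕ} (x : V d) (s : ℕ → V d) (I : Finset ℕ) : Finset (V d) :=
  I.image (pos x s)

/-- Probability that the walk started at `z` hits both `A` and `B` in finite time
(increasing limit of the finite-horizon probabilities). -/
noncomputable def hitBothProb (d : ℕ) (A B : Finset (V d)) (z : V d) : ℝ :=
  ⨆ n : ℕ, probN d n (fun s => (∃ k ≤ n, pos z s k ∈ A) ∧ (∃ k ≤ n, pos z s k ∈ B))

/-- The discrete cube `Q(x,r) = [x - r/2, x + r/2)^d ∩ ℤ^d`. -/
def cube {d : ℕ} (x : V d) (r : ℝ) : Set (V d) :=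
  {y | ∀ i, (x i : ℝ) - r / 2 ≤ (y i : ℝ) ∧ (y i : ℝ) < (x i : ℝ) + r / 2}

/-- The corrector `ξ_n(T)`. -/
noncomputable def xi (d n T : ℕ) (s : ℕ → V d) : ℝ :=
  ∑ k ∈ Finset.range (n + 1), ∑ x ∈ rangeOn 0 s (Finset.Icc 0 k),
    esc d (↑(rangeOn 0 s (Finset.Icc 0 k))) x * (GconvGT d T (x - pos 0 s k) / T)

/-- The capacity cross-term `χ_C(A,B) = Cap(A) + Cap(B) - Cap(A ∪ B)`. -/
noncomputable def chiC {d : ℕ} (A B : Finset (V d)) : ℝ := cap A + cap B - cap (A ∪ B)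

open Classical in
/-- Conditional expectation, given the first `m` steps (equal to those of `s`),
of a functional of the first `n` steps. -/
noncomputable def condExpN (d n m : ℕ) (f : (ℕ → V d) → ℝ) (s : ℕ → V d) : ℝ :=
  expN d n (fun s' => if ∀ i < m, s' i = s i then f s' else 0) * ((2 * d : ℕ) : ℝ) ^ m

/-- The compensator `ξ_n^*(T)`. -/
noncomputable def xiStar (d n T : ℕ) (s : ℕ → V d) : ℝ :=
  (1 / (T : ℝ)) * ∑ j ∈ Finset.range T, ∑ l ∈ Finset.Icc 1 (n / T - 1),
    condExpN d (n + T) (j + l * T)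
      (fun s' => chiC (rangeOn 0 s' (Finset.Icc j (j + l * T)))
        (rangeOn 0 s' (Finset.Icc (j + l * T) (j + (l + 1) * T)))) s

/-- `E[Cap(R_n)]`, the expected capacity of the range up to time `n`. -/
noncomputable def expCapRange (d n : ℕ) : ℝ :=
  expN d n (fun s => cap (rangeOn 0 s (Finset.Icc 0 n)))

/-- The maximal capacity `c_n` of the range of a nearest-neighbor path with `n` steps. -/
noncomputable def maxPathCap (d n : ℕ) : ℝ :=
  sSup {y : ℝ | ∃ (x : V d) (s : ℕ → V d), (∀ i, s i ∈ steps d) ∧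
    y = cap (rangeOn x s (Finset.Icc 0 n))}

/-- `Γ(A,Λ) = Σ_{x∈A} Σ_{y∈Λ} G(y-x) P_y(H_Λ^+ = ∞)`. -/
noncomputable def GamFin (d : ℕ) (A : Finset (V d)) (Λ : Set (V d)) : ℝ :=
  ∑ x ∈ A, ∑' y : Λ, G d ((y : V d) - x) * esc d Λ (y : V d)

/-- `P(Γ(R̃_∞, Λ) > t)`, as the increasing limit of the finite-horizon probabilities. -/
noncomputable def PGam (d : ℕ) (Λ : Set (V d)) (t : ℝ) : ℝ :=
  ⨆ N : ℕ, probN d N (fun s => t < GamFin d (rangeOn 0 s (Finset.Icc 0 N)) Λ)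

/-- `E_x[Γ(R̃_∞, Λ)]`, as the increasing limit of the finite-horizon expectations. -/
noncomputable def EGam (d : ℕ) (x : V d) (Λ : Set (V d)) : ℝ :=
  ⨆ N : ℕ, expN d N (fun s => GamFin d (rangeOn x s (Finset.Icc 0 N)) Λ)

/-- The law of the first `n` steps of two independent simple random walks:
uniform measure on pairs of admissible step sequences of length `n`. -/
noncomputable def pairLevel (d n : ℕ) : Measure ((Fin n → V d) × (Fin n → V d)) :=
  (((2 * d : ℕ) : ℝ≥0∞) ^ (2 * n))⁻¹ •
    ∑ a ∈ Fintype.piFinset fun _ : Fin n => steps d,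
      ∑ b ∈ Fintype.piFinset fun _ : Fin n => steps d, Measure.dirac (a, b)

open Classical in
/-- `Γ(R̃_∞, R_∞) = Σ_{x ∈ R̃_∞} Σ_{y ∈ R_∞} G(y-x) P_y(H_{R_∞}^+ = ∞)` for
two (step sequences of) walks, with values in `ℝ≥0∞`. -/
noncomputable def gammaInf (d : ℕ) (sA sB : ℕ → V d) : ℝ≥0∞ :=
  ∑' x : V d, ∑' y : V d,
    if x ∈ Set.range (pos (0 : V d) sA) ∧ y ∈ Set.range (pos (0 : V d) sB) then
      ENNReal.ofReal (G d (y - x) * esc d (Set.range (pos (0 : V d) sB)) y)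
    else 0

theorem rpow_neg_add_rpow_neg_le (β : ℝ) :
    ∃ δ K : ℝ, 0 < δ ∧ δ < 1 ∧ 0 ≤ K ∧ ∀ u : ℝ, |u| ≤ δ →
      (1 + u) ^ (-β) + (1 - u) ^ (-β) ≤ 2 + β * (β + 1) * u ^ 2 + K * u ^ 4 := by
  have hO := (Real.one_add_rpow_hasFPowerSeriesAt_zero (a := -β)).isBigO_sub_partialSum_pow 4
  obtain ⟨c, hc, hO⟩ := hO.exists_pos
  rw [Asymptotics.isBigOWith_iff, Metric.eventually_nhds_iff] at hO
  obtain ⟨ε, hε, hO⟩ := hO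
  have hchoose : Ring.choose (-β) 2 = β * (β + 1) / 2 := by
    rw [Ring.choose_eq_smul, ← Polynomial.aeval_eq_smeval]
    simp [descPochhammer_succ_right]
    ring
  refine ⟨min (ε / 2) (1 / 2), 2 * c, by positivity,
    (min_le_right _ _).trans_lt (by norm_num), by positivity, fun u hu => ?_⟩
  have hu' : |u| < ε := hu.trans_lt ((min_le_left _ _).trans_lt (by linarith))
  have hpos := hO (y := u) (by simpa using hu')
  have hneg := hO (y := -u) (by simpa using hu')
  simp only [zero_add, FormalMultilinearSeries.partialSum, Finset.sum_range_succ,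
    Finset.sum_range_zero, binomialSeries_apply, Ring.choose_zero_right, Ring.choose_one_right,
    hchoose, Real.norm_eq_abs, abs_neg, List.ofFn_const, List.prod_replicate, smul_eq_mul,
    abs_pow, show |u| ^ 4 = u ^ 4 from by rw [← abs_pow]; exact abs_of_nonneg (by positivity)]
    at hpos hneg
  have h1 := (abs_le.1 hpos).2
  have h2 := (abs_le.1 hneg).2
  rw [← sub_eq_add_neg] at h2
  linarith

theorem rpow_neg_mul_le_sub_one_rpow_neg {β B : ℝ} (hβ : 0 ≤ β) (hB : 1 < B) :
    B ^ (-β) * (1 + β / B) ≤ (B - 1) ^ (-β) := by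
  have hB0 : 0 < B := by linarith
  have hq : 0 < 1 - B⁻¹ := by
    have := inv_lt_one_of_one_lt₀ hB
    linarith
  have hfac : B - 1 = B * (1 - B⁻¹) := by field_simp
  rw [hfac, Real.mul_rpow hB0.le hq.le]
  gcongr
  rw [Real.rpow_def_of_pos hq]
  have hlog := Real.log_le_sub_one_of_pos hq
  have hmul : β / B ≤ Real.log (1 - B⁻¹) * -β := by
    rw [div_eq_mul_inv]
    nlinarith
  linarith [Real.add_one_le_exp (Real.log (1 - B⁻¹) * -β)]

/-- The transition operator of the simple random walk. -/
noncomputable def stepAvg (d : ℕ) : (V d → ℝ) →ₗ[ℝ] (V d → ℝ) where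
  toFun f x := (∑ e ∈ steps d, f (x - e)) / ((2 * d : ℕ) : ℝ)
  map_add' f g := by
    ext x
    simp [Finset.sum_add_distrib, add_div]
  map_smul' c f := by
    ext x
    simp [← Finset.mul_sum, mul_div_assoc]

theorem stepAvg_apply {d : ℕ} (f : V d → ℝ) (x : V d) :
    stepAvg d f x = (∑ e ∈ steps d, f (x - e)) / ((2 * d : ℕ) : ℝ) := rfl

theorem sum_steps {d : ℕ} (F : V d → ℝ) :
    ∑ e ∈ steps d, F e = ∑ i, (F (Pi.single i 1) + F (-Pi.single i 1)) := by
  rw [steps, Finset.sum_image, Fintype.sum_prod_type]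
  · refine Finset.sum_congr rfl fun i _ => ?_
    rw [Fintype.sum_bool]
    congr 2
    · ext j
      simp [Pi.single_apply]
    · ext j
      by_cases h : j = i <;> simp [h]
  · rintro ⟨i, a⟩ - ⟨j, b⟩ - h
    have hi := congrFun h i
    have hij : i = j := by
      by_contra hne
      cases a <;> simp [hne] at hi
    subst hij
    cases a <;> cases b <;> simp at hi ⊢

theorem stepAvg_mono {d : ℕ} {f g : V d → ℝ} (h : f ≤ g) : stepAvg d f ≤ stepAvg d g := by
  intro x
  rw [stepAvg_apply, stepAvg_apply]
  gcongr
  exact h _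

theorem stepAvg_pow_mono {d : ℕ} {f g : V d → ℝ} (h : f ≤ g) (n : ℕ) :
    (stepAvg d ^ n) f ≤ (stepAvg d ^ n) g := by
  induction n with
  | zero => simpa using h
  | succ n ih =>
    rw [pow_succ']
    exact stepAvg_mono ih

theorem stepAvg_pow_le_self {d : ℕ} {f : V d → ℝ} (h : stepAvg d f ≤ f) (n : ℕ) :
    (stepAvg d ^ n) f ≤ f := by
  induction n with
  | zero => simp
  | succ n ih =>
    rw [pow_succ']
    exact (stepAvg_mono ih).trans h

theorem sum_stepAvg_pow_le {d : ℕ} {f g : V d → ℝ} (hf : 0 ≤ f) (h : g ≤ f - stepAvg d f)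
    (N : ℕ) : ∑ n ∈ Finset.range N, (stepAvg d ^ n) g ≤ f := by
  induction N with
  | zero => simpa using hf
  | succ N ih =>
    have hrec : ∑ n ∈ Finset.range (N + 1), (stepAvg d ^ n) g =
        stepAvg d (∑ n ∈ Finset.range N, (stepAvg d ^ n) g) + g := by
      rw [Finset.sum_range_succ', map_sum]
      simp [pow_succ']
    rw [hrec]
    calc _ ≤ stepAvg d f + (f - stepAvg d f) := add_le_add (stepAvg_mono ih) h
      _ = f := by abel

theorem stepAvg_pow_apply {d : ℕ} (n : ℕ) (f : V d → ℝ) (x : V d) :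
    (stepAvg d ^ n) f x =
      (∑ s ∈ Fintype.piFinset fun _ : Fin n => steps d, f (x - ∑ i, s i)) /
        ((2 * d : ℕ) : ℝ) ^ n := by
  induction n generalizing x with
  | zero => simp
  | succ n ih =>
    rw [pow_succ', Module.End.mul_apply, stepAvg_apply]
    simp_rw [ih]
    rw [← Finset.sum_div, div_div, ← pow_succ]
    congr 1
    rw [← Finset.sum_product']
    refine Finset.sum_equiv (Fin.consEquiv fun _ => V d) (fun p => ?_) (fun p _ => ?_)
    · simp [Fin.consEquiv, Fin.forall_fin_succ]
    · simp [Fin.consEquiv, Fin.sum_univ_succ, sub_sub]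

theorem pos_zero_extend {d n : ℕ} (s : Fin n → V d) :
    pos 0 (fun i => if h : i < n then s ⟨i, h⟩ else 0) n = ∑ i, s i := by
  rw [pos, zero_add, Finset.sum_range]
  simp

theorem probN_pos_eq {d : ℕ} (n : ℕ) (z : V d) :
    probN d n (fun s => pos 0 s n = z) =
      (∑ s ∈ Fintype.piFinset fun _ : Fin n => steps d, if ∑ i, s i = z then (1 : ℝ) else 0) /
        ((2 * d : ℕ) : ℝ) ^ n := by
  simp only [probN, pos_zero_extend]
  rw [Finset.sum_boole]

theorem probN_pos_eq_stepAvg_pow {d : ℕ} (n : ℕ) (z : V d) :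
    probN d n (fun s => pos 0 s n = z) = (stepAvg d ^ n) (Pi.single 0 1) z := by
  rw [probN_pos_eq, stepAvg_pow_apply]
  congr! 2 with s
  simp [Pi.single_apply, sub_eq_zero, eq_comm]

theorem hasSum_mul_probN_pos {d : ℕ} (n : ℕ) (f : V d → ℝ) (x : V d) :
    HasSum (fun y => f (x - y) * probN d n (fun s => pos 0 s n = y)) ((stepAvg d ^ n) f x) := by
  simp_rw [probN_pos_eq, stepAvg_pow_apply, ← mul_div_assoc, Finset.mul_sum]
  refine HasSum.div_const (hasSum_sum fun s _ => ?_) _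
  have hite : (fun y => f (x - y) * if ∑ i, s i = y then (1 : ℝ) else 0) =
      fun y => if y = ∑ i, s i then f (x - ∑ i, s i) else 0 := by
    ext y
    split_ifs <;> simp_all
  rw [hite]
  exact hasSum_ite_eq _ _

theorem GconvGT_eq {d : ℕ} (T : ℕ) (x : V d) :
    GconvGT d T x = ∑ n ∈ Finset.range (T + 1), (stepAvg d ^ n) (G d) x := by
  rw [GconvGT]
  simp_rw [GT, Finset.mul_sum]
  exact (hasSum_sum fun n _ => hasSum_mul_probN_pos n (G d) x).tsum_eq

/-- The regularization `(a + ‖x‖²)^(-β)` of a negative power of the norm. -/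
noncomputable def regPow (d : ℕ) (β a : ℝ) (x : V d) : ℝ :=
  (a + ∑ i, (x i : ℝ) ^ 2) ^ (-β)

theorem sum_sq_add_smul_single {d : ℕ} (x : V d) (i : Fin d) (ε : ℤ) :
    ∑ j, (((x + Pi.single i ε : V d) j : ℤ) : ℝ) ^ 2 = ∑ j, (x j : ℝ) ^ 2 + (2 * ε * x i + ε ^ 2) := by
  rw [← sub_eq_iff_eq_add', ← Finset.sum_sub_distrib, Finset.sum_eq_single i]
  · simp
    ring
  · intro j _ hj
    simp [hj]
  · simp

theorem stepAvg_regPow_apply {d : ℕ} (β a : ℝ) (x : V d) :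
    stepAvg d (regPow d β a) x =
      (∑ i, ((a + ∑ j, (x j : ℝ) ^ 2 + 1 + 2 * x i) ^ (-β) +
        (a + ∑ j, (x j : ℝ) ^ 2 + 1 - 2 * x i) ^ (-β))) / (2 * d) := by
  rw [stepAvg_apply, sum_steps fun e => regPow d β a (x - e)]
  push_cast
  congr 1
  refine Finset.sum_congr rfl fun i _ => ?_
  rw [add_comm]
  simp only [regPow]
  congr 2
  · rw [sub_neg_eq_add, sum_sq_add_smul_single]
    push_cast
    ring
  · rw [sub_eq_add_neg, ← Pi.single_neg, sum_sq_add_smul_single]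
    push_cast
    ring

/-- For large `a`, the defect of harmonicity of `(a + ‖x‖²)^(-β)` is bounded below by its
second-order term. -/
theorem exists_le_regPow_sub_stepAvg {d : ℕ} (hd : 0 < d) {β : ℝ} (hβ : 0 < β) :
    ∃ a₀ : ℝ, 1 ≤ a₀ ∧ ∀ a, a₀ ≤ a → ∀ x : V d,
      (a + ∑ i, (x i : ℝ) ^ 2 + 1) ^ (-β) *
        (β * (1 - 2 * (β + 1) / d) / (a + ∑ i, (x i : ℝ) ^ 2 + 1) +
          1 / (a + ∑ i, (x i : ℝ) ^ 2 + 1) ^ 2) ≤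
      regPow d β a x - stepAvg d (regPow d β a) x := by
  obtain ⟨δ, K, hδ, hδ1, hK, hTaylor⟩ := rpow_neg_add_rpow_neg_le β
  have hd' : (0 : ℝ) < d := by exact_mod_cast hd
  refine ⟨max 1 (max (4 / δ ^ 2) ((8 * K / d + 1) * d / (2 * β * (β + 1)))), le_max_left _ _,
    fun a ha x => ?_⟩
  simp only [max_le_iff] at ha
  obtain ⟨ha1, haδ, haK⟩ := ha
  set q := ∑ i, (x i : ℝ) ^ 2 with hq
  have hq0 : 0 ≤ q := Finset.sum_nonneg fun i _ => sq_nonneg _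
  set B := a + q + 1 with hB
  have hB0 : 0 < B := by positivity
  have hxq : ∀ i, (x i : ℝ) ^ 2 ≤ q := fun i =>
    Finset.single_le_sum (f := fun i => (x i : ℝ) ^ 2) (fun i _ => sq_nonneg _)
      (Finset.mem_univ i)
  have hterm : ∀ i, (B + 2 * x i) ^ (-β) + (B - 2 * x i) ^ (-β) ≤
      B ^ (-β) * (2 + 4 * β * (β + 1) / B ^ 2 * x i ^ 2 + 16 * K * q / B ^ 4 * x i ^ 2) := by
    intro i
    have hsq : (2 * x i / B) ^ 2 ≤ δ ^ 2 := by
      rw [div_pow, div_le_iff₀ (by positivity)]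
      rw [div_le_iff₀ (by positivity)] at haδ
      have h1 : (2 * (x i : ℝ)) ^ 2 ≤ 4 * B := by nlinarith [hxq i]
      have h2 : 4 * B ≤ (a * δ ^ 2) * B := by gcongr
      have h3 : a * δ ^ 2 * B ≤ δ ^ 2 * B ^ 2 := by
        have : a ≤ B := by linarith
        have : a * (δ ^ 2 * B) ≤ B * (δ ^ 2 * B) := by gcongr
        linarith
      linarith
    have hu : |2 * x i / B| ≤ δ := abs_le_of_sq_le_sq hsq hδ.le
    have hu2 := abs_le.1 hu
    have e1 : B + 2 * x i = B * (1 + 2 * x i / B) := by field_simp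
    have e2 : B - 2 * x i = B * (1 - 2 * x i / B) := by field_simp
    rw [e1, e2, Real.mul_rpow hB0.le (by linarith), Real.mul_rpow hB0.le (by linarith), ← mul_add]
    refine mul_le_mul_of_nonneg_left ((hTaylor _ hu).trans ?_) (by positivity)
    have h4 : K * (2 * x i / B) ^ 4 ≤ 16 * K * q / B ^ 4 * x i ^ 2 := by
      calc K * (2 * x i / B) ^ 4
          _ = 16 * K * (x i) ^ 2 / B ^ 4 * x i ^ 2 := by
            rw [div_pow]
            ring
          _ ≤ _ := by
            gcongr
            exact hxq i
    have h5 : β * (β + 1) * (2 * x i / B) ^ 2 = 4 * β * (β + 1) / B ^ 2 * x i ^ 2 := by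
      rw [div_pow]
      ring
    linarith
  have hstep : stepAvg d (regPow d β a) x ≤
      B ^ (-β) * (1 + 2 * β * (β + 1) / d * q / B ^ 2 + 8 * K / d / B ^ 2) := by
    rw [stepAvg_regPow_apply, div_le_iff₀ (by positivity)]
    refine (Finset.sum_le_sum fun i _ => hterm i).trans ?_
    rw [← Finset.mul_sum, mul_assoc (B ^ (-β))]
    refine mul_le_mul_of_nonneg_left ?_ (by positivity)
    rw [Finset.sum_add_distrib, Finset.sum_add_distrib, ← Finset.mul_sum, ← Finset.mul_sum, ← hq,
      Finset.sum_const, Finset.card_univ, Fintype.card_fin, nsmul_eq_mul]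
    have h6 : 16 * K * q / B ^ 4 * q ≤ 16 * K / B ^ 2 := by
      rw [div_mul_eq_mul_div, div_le_div_iff₀ (by positivity) (by positivity)]
      have : q * q ≤ B ^ 2 := by nlinarith
      calc 16 * K * q * q * B ^ 2 = 16 * K * B ^ 2 * (q * q) := by ring
        _ ≤ 16 * K * B ^ 2 * B ^ 2 := by gcongr
        _ = _ := by ring
    have h7 : (1 + 2 * β * (β + 1) / d * q / B ^ 2 + 8 * K / d / B ^ 2) * (2 * d) =
        d * 2 + 4 * β * (β + 1) / B ^ 2 * q + 16 * K / B ^ 2 := by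
      field_simp
      ring
    linarith
  have hself : B ^ (-β) * (1 + β / B) ≤ regPow d β a x := by
    have := rpow_neg_mul_le_sub_one_rpow_neg hβ.le (show 1 < B by linarith)
    rwa [show B - 1 = a + q by rw [hB]; ring] at this
  have hgap : β * (1 - 2 * (β + 1) / d) / B + 1 / B ^ 2 ≤
      (1 + β / B) - (1 + 2 * β * (β + 1) / d * q / B ^ 2 + 8 * K / d / B ^ 2) := by
    rw [div_le_iff₀ (by positivity)] at haK
    have hK' : 8 * K / d + 1 ≤ 2 * β * (β + 1) / d * (a + 1) := by
      rw [div_mul_eq_mul_div, le_div_iff₀ hd']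
      nlinarith [mul_pos hβ (show 0 < β + 1 by linarith)]
    have hid : (1 + β / B) - (1 + 2 * β * (β + 1) / d * q / B ^ 2 + 8 * K / d / B ^ 2) -
        (β * (1 - 2 * (β + 1) / d) / B + 1 / B ^ 2) =
        (2 * β * (β + 1) / d * (a + 1) - (8 * K / d + 1)) / B ^ 2 := by
      rw [show a + 1 = B - q by rw [hB]; ring]
      field_simp
      ring
    rw [← sub_nonneg, hid]
    exact div_nonneg (by linarith) (by positivity)
  calc _ ≤ B ^ (-β) * ((1 + β / B) -
        (1 + 2 * β * (β + 1) / d * q / B ^ 2 + 8 * K / d / B ^ 2)) := by gcongr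
    _ ≤ _ := by
      rw [mul_sub]
      linarith

theorem regPow_nonneg {d : ℕ} (β : ℝ) {a : ℝ} (ha : 0 ≤ a) : 0 ≤ regPow d β a := by
  intro x
  have hq : 0 ≤ ∑ i, (x i : ℝ) ^ 2 := Finset.sum_nonneg fun i _ => sq_nonneg _
  exact Real.rpow_nonneg (by linarith) _

theorem regPow_le {d : ℕ} (k : ℕ) {a : ℝ} (ha : 1 ≤ a) (x : V d) :
    regPow d ((k : ℝ) / 2) a x ≤ 2 * (1 / (1 + nrm x ^ k)) := by
  have hq : 0 ≤ ∑ i, (x i : ℝ) ^ 2 := Finset.sum_nonneg fun i _ => sq_nonneg _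
  have hk : (0 : ℝ) ≤ (k : ℝ) / 2 := by positivity
  have hA : 0 < a + ∑ i, (x i : ℝ) ^ 2 := by linarith
  have hone : 1 ≤ (a + ∑ i, (x i : ℝ) ^ 2) ^ ((k : ℝ) / 2) :=
    Real.one_le_rpow (by linarith) hk
  have hnrm : nrm x ^ k ≤ (a + ∑ i, (x i : ℝ) ^ 2) ^ ((k : ℝ) / 2) := by
    rw [nrm, Real.sqrt_eq_rpow, ← Real.rpow_natCast, ← Real.rpow_mul hq]
    calc _ = (∑ i, (x i : ℝ) ^ 2) ^ ((k : ℝ) / 2) := by congr 1; ring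
      _ ≤ _ := Real.rpow_le_rpow hq (by linarith) hk
  have hn : 0 ≤ nrm x ^ k := pow_nonneg (Real.sqrt_nonneg _) _
  rw [regPow, Real.rpow_neg hA.le, inv_eq_one_div, ← mul_div_assoc,
    div_le_div_iff₀ (by linarith) (by linarith)]
  linarith

theorem G_le_of_single_le {d : ℕ} {f : V d → ℝ} (hf : 0 ≤ f)
    (h : Pi.single 0 1 ≤ f - stepAvg d f) : G d ≤ f := by
  intro z
  refine Real.tsum_le_of_sum_range_le (fun n => ?_) fun N => ?_
  · rw [probN]
    positivity
  · simp_rw [probN_pos_eq_stepAvg_pow]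
    simpa using sum_stepAvg_pow_le hf h N z

/-- Supersolutions controlling `G` and its potential: `G ≤ c • (a + ‖x‖²)^(-(d-2)/2)`, which is
superharmonic and dominated by the Laplacian of a multiple of `(a + ‖x‖²)^(-(d-4)/2)`. -/
theorem exists_G_le_regPow {d : ℕ} (hd : 5 ≤ d) :
    ∃ a c c' : ℝ, 1 ≤ a ∧ 0 < c ∧ 0 < c' ∧
      G d ≤ c • regPow d (((d - 2 : ℕ) : ℝ) / 2) a ∧
      stepAvg d (regPow d (((d - 2 : ℕ) : ℝ) / 2) a) ≤ regPow d (((d - 2 : ℕ) : ℝ) / 2) a ∧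
      regPow d (((d - 2 : ℕ) : ℝ) / 2) a ≤ c' • (regPow d (((d - 4 : ℕ) : ℝ) / 2) a -
        stepAvg d (regPow d (((d - 4 : ℕ) : ℝ) / 2) a)) := by
  have hdR : (5 : ℝ) ≤ d := by exact_mod_cast hd
  have hd0 : (d : ℝ) ≠ 0 := by linarith
  have h2 : ((d - 2 : ℕ) : ℝ) = d - 2 := by
    rw [Nat.cast_sub (by omega)]
    norm_num
  have h4 : ((d - 4 : ℕ) : ℝ) = d - 4 := by
    rw [Nat.cast_sub (by omega)]
    norm_num
  rw [h2, h4]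
  set β : ℝ := (d - 2) / 2 with hβ
  set γ : ℝ := (d - 4) / 2 with hγ
  have hβ0 : 0 < β := by rw [hβ]; linarith
  have hγ0 : 0 < γ := by rw [hγ]; linarith
  have hβγ : -γ - 1 = -β := by rw [hβ, hγ]; ring
  obtain ⟨a₁, ha₁, H₁⟩ := exists_le_regPow_sub_stepAvg (d := d) (by omega) hβ0
  obtain ⟨a₂, ha₂, H₂⟩ := exists_le_regPow_sub_stepAvg (d := d) (by omega) hγ0
  set a := max a₁ a₂ with ha
  have ha1 : 1 ≤ a := ha₁.trans (le_max_left _ _)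
  have hq : ∀ x : V d, 0 ≤ ∑ i, (x i : ℝ) ^ 2 := fun x => Finset.sum_nonneg fun i _ => sq_nonneg _
  have hβcrit : β * (1 - 2 * (β + 1) / d) = 0 := by
    rw [show 2 * (β + 1) = d by rw [hβ]; ring, div_self hd0]
    ring
  have hγcrit : γ * (1 - 2 * (γ + 1) / d) = 2 * γ / d := by
    rw [show 2 * (γ + 1) = d - 2 by rw [hγ]; ring]
    field_simp
    ring
  have D₁ := H₁ a (le_max_left _ _)
  have D₂ := H₂ a (le_max_right _ _)
  simp only [hβcrit, zero_div, zero_add] at D₁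
  simp only [hγcrit] at D₂
  have hsuper : stepAvg d (regPow d β a) ≤ regPow d β a := by
    intro x
    have := hq x
    rw [← sub_nonneg]
    exact le_trans (by positivity) (D₁ x)
  set c₀ := (a + 1) ^ (-β) * (1 / (a + 1) ^ 2) with hc₀
  have hc₀0 : 0 < c₀ := by positivity
  set c₁ := 2 * γ / d * 2 ^ (-β) with hc₁
  have hc₁0 : 0 < c₁ := by positivity
  refine ⟨a, c₀⁻¹, c₁⁻¹, ha1, by positivity, by positivity, ?_, hsuper, fun x => ?_⟩
  · refine G_le_of_single_le (smul_nonneg (by positivity) (regPow_nonneg _ (by linarith))) ?_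
    rw [map_smul, ← smul_sub]
    intro x
    by_cases hx : x = 0
    · subst hx
      have := D₁ 0
      simp only [Pi.zero_apply, Int.cast_zero, ne_eq, OfNat.ofNat_ne_zero, not_false_eq_true,
        zero_pow, Finset.sum_const_zero, add_zero] at this
      simp only [Pi.single_eq_same, Pi.smul_apply, Pi.sub_apply, smul_eq_mul]
      rw [le_inv_mul_iff₀ hc₀0, mul_one]
      exact this
    · rw [Pi.single_eq_of_ne hx]
      exact mul_nonneg (by positivity) (sub_nonneg.2 (hsuper x))
  · simp only [Pi.smul_apply, Pi.sub_apply, smul_eq_mul]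
    rw [le_inv_mul_iff₀ hc₁0]
    refine le_trans ?_ (D₂ x)
    have hqx := hq x
    rw [regPow]
    set A := a + ∑ i, (x i : ℝ) ^ 2 with hA
    have hA0 : 0 < A := by positivity
    calc c₁ * A ^ (-β) = 2 * γ / d * (2 * A) ^ (-β) := by
          rw [Real.mul_rpow (by norm_num) hA0.le, hc₁, mul_assoc]
      _ ≤ 2 * γ / d * (A + 1) ^ (-β) := by
          refine mul_le_mul_of_nonneg_left ?_ (by positivity)
          exact Real.rpow_le_rpow_of_nonpos (by positivity) (by linarith) (by linarith)
      _ = (A + 1) ^ (-γ) * (2 * γ / d / (A + 1)) := by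
          rw [← hβγ, Real.rpow_sub_one (by positivity)]
          ring
      _ ≤ _ := by
          refine mul_le_mul_of_nonneg_left ?_ (by positivity)
          exact le_add_of_nonneg_right (by positivity)

/-- For `d ≥ 5` there is `C₂ > 0` such that for all `x ∈ ℤ^d` and `T ≥ 1`,
`(G⋆G_T)(x)/T ≤ C₂ · min(1/(1+‖x‖^{d-2}), 1/(T(1+‖x‖^{d-4})))`. -/
theorem GconvGT_div_le {d : ℕ} (hd : 5 ≤ d) :
    ∃ C₂ : ℝ, 0 < C₂ ∧ ∀ (x : V d) (T : ℕ), 1 ≤ T →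
      GconvGT d T x / T ≤
        C₂ * min (1 / (1 + nrm x ^ (d - 2))) (1 / (T * (1 + nrm x ^ (d - 4)))) := by
  obtain ⟨a, c, c', ha, hc, hc', hG, hsuper, hpot⟩ := exists_G_le_regPow hd
  refine ⟨4 * c + 2 * (c * c'), by positivity, fun x T hT => ?_⟩
  have hT1 : (1 : ℝ) ≤ T := by exact_mod_cast hT
  have hn : 0 ≤ nrm x := Real.sqrt_nonneg _
  have hlinear : GconvGT d T x ≤ 4 * c * (T * (1 / (1 + nrm x ^ (d - 2)))) := by
    have hpow : ∀ n, (stepAvg d ^ n) (G d) x ≤ 2 * c * (1 / (1 + nrm x ^ (d - 2))) := fun n =>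
      calc (stepAvg d ^ n) (G d) x
          ≤ (stepAvg d ^ n) (c • regPow d (((d - 2 : ℕ) : ℝ) / 2) a) x := stepAvg_pow_mono hG n x
        _ = c * (stepAvg d ^ n) (regPow d (((d - 2 : ℕ) : ℝ) / 2) a) x := by
          rw [map_smul, Pi.smul_apply, smul_eq_mul]
        _ ≤ c * (2 * (1 / (1 + nrm x ^ (d - 2)))) := by
          gcongr
          exact (stepAvg_pow_le_self hsuper n x).trans (regPow_le _ ha x)
        _ = _ := by ring
    rw [GconvGT_eq]
    calc _ ≤ ∑ n ∈ Finset.range (T + 1), 2 * c * (1 / (1 + nrm x ^ (d - 2))) :=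
          Finset.sum_le_sum fun n _ => hpow n
      _ = (T + 1) * (2 * c * (1 / (1 + nrm x ^ (d - 2)))) := by simp
      _ ≤ (2 * T) * (2 * c * (1 / (1 + nrm x ^ (d - 2)))) := by
          gcongr
          linarith
      _ = _ := by ring
  have hbounded : GconvGT d T x ≤ 2 * (c * c') * (1 / (1 + nrm x ^ (d - 4))) := by
    set f := (c * c') • regPow d (((d - 4 : ℕ) : ℝ) / 2) a with hf
    have hGf : G d ≤ f - stepAvg d f := by
      rw [hf, map_smul, ← smul_sub, mul_smul]
      exact hG.trans (smul_le_smul_of_nonneg_left hpot hc.le)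
    have hf0 : 0 ≤ f := smul_nonneg (by positivity) (regPow_nonneg _ (by linarith))
    rw [GconvGT_eq, ← Finset.sum_apply]
    refine (sum_stepAvg_pow_le hf0 hGf (T + 1) x).trans ?_
    calc f x ≤ c * c' * (2 * (1 / (1 + nrm x ^ (d - 4)))) := by
          rw [hf, Pi.smul_apply, smul_eq_mul]
          gcongr
          exact regPow_le _ ha x
      _ = _ := by ring
  rw [mul_min_of_nonneg _ _ (by positivity), le_min_iff, div_le_iff₀ (by positivity),
    div_le_iff₀ (by positivity)]
  constructor
  · refine hlinear.trans ?_
    have : 0 ≤ 2 * (c * c') * (T * (1 / (1 + nrm x ^ (d - 2)))) := by positivity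
    linarith
  · have hcancel : (4 * c + 2 * (c * c')) * (1 / (T * (1 + nrm x ^ (d - 4)))) * T =
        (4 * c + 2 * (c * c')) * (1 / (1 + nrm x ^ (d - 4))) := by
      field_simp
    rw [hcancel]
    refine hbounded.trans ?_
    gcongr
    linarith

end SRW
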